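/- Let d_1, …, d_r be positive integers with s = (1/2)·Σ_{i=1}^r d_i > 0 and let T be the expected triangle count of the CL model. Then for every index ℓ ∈ {1, …, r}, T ≤ (Σ_{i=1}^r d_i²) · [ (Σ_{i=1}^r d_i²)·(Σ_{i ≤ ℓ} d_i²)/(8·s³) + (Σ_{i ≥ ℓ} d_i)²/(4·s²) ]. -/

import Mathlib

open Finset

/-- Edge probability of the Chung–Lu model: `p i j = min 1 (d i * d j / (2 s))`. -/
noncomputable def clP {r : ℕ} (d : Fin r → ℕ) (s : ℝ) (i j : Fin r) : ℝ :=
  min 1 ((d i : ℝ) * (d j : ℝ) / (2 * s))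

/-- Expected triangle count of the Chung–Lu model:
`T = ∑_{i < j < k} p i j * p j k * p i k`. -/
noncomputable def clT {r : ℕ} (d : Fin r → ℕ) (s : ℝ) : ℝ :=
  ∑ t ∈ Finset.univ.filter
      (fun t : Fin r × Fin r × Fin r => t.1 < t.2.1 ∧ t.2.1 < t.2.2),
    clP d s t.1 t.2.1 * clP d s t.2.1 t.2.2 * clP d s t.1 t.2.2

theorem clP_nonneg {r : ℕ} (d : Fin r → ℕ) {s : ℝ} (hs : 0 < s) (i j : Fin r) :
    0 ≤ clP d s i j :=
  le_min zero_le_one (by positivity)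

theorem clP_le_one {r : ℕ} (d : Fin r → ℕ) (s : ℝ) (i j : Fin r) : clP d s i j ≤ 1 :=
  min_le_left _ _

theorem clP_le_div {r : ℕ} (d : Fin r → ℕ) (s : ℝ) (i j : Fin r) :
    clP d s i j ≤ (d i : ℝ) * d j / (2 * s) :=
  min_le_right _ _

/-- Bounding all three edge probabilities by their weights. -/
theorem clP_triangle_le {r : ℕ} (d : Fin r → ℕ) {s : ℝ} (hs : 0 < s) (i j k : Fin r) :
    clP d s i j * clP d s j k * clP d s i k ≤
      (d i : ℝ) ^ 2 * (d j : ℝ) ^ 2 * (d k : ℝ) ^ 2 / (8 * s ^ 3) := by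
  have h := clP_nonneg d hs
  calc clP d s i j * clP d s j k * clP d s i k
      ≤ ((d i : ℝ) * d j / (2 * s)) * ((d j : ℝ) * d k / (2 * s)) *
          ((d i : ℝ) * d k / (2 * s)) := by
        gcongr <;> first | exact clP_le_div d s _ _ | exact h _ _
    _ = _ := by field_simp; ring

/-- Bounding only the two edge probabilities at `i` by their weights. -/
theorem clP_triangle_le_of_apex {r : ℕ} (d : Fin r → ℕ) {s : ℝ} (hs : 0 < s)
    (i j k : Fin r) :
    clP d s i j * clP d s j k * clP d s i k ≤
      (d i : ℝ) ^ 2 * (d j : ℝ) * (d k : ℝ) / (4 * s ^ 2) := by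
  have h := clP_nonneg d hs
  calc clP d s i j * clP d s j k * clP d s i k
      ≤ ((d i : ℝ) * d j / (2 * s)) * 1 * ((d i : ℝ) * d k / (2 * s)) := by
        gcongr <;>
          first | exact clP_le_div d s _ _ | exact clP_le_one d s _ _ | exact h _ _
    _ = _ := by field_simp; ring

theorem sum_prod_mul_mul {ι R : Type*} [Fintype ι] [CommSemiring R] (f g h : ι → R) :
    ∑ t : ι × ι × ι, f t.1 * g t.2.1 * h t.2.2 = (∑ i, f i) * (∑ i, g i) * ∑ i, h i := by
  simp only [Fintype.sum_prod_type, mul_assoc, Finset.sum_mul_sum, ← Finset.mul_sum]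

/-- For every index `ℓ`, the expected triangle count of the CL model satisfies
`T ≤ (∑ d i ^ 2) · [ (∑ d i ^ 2)(∑_{i ≤ ℓ} d i ^ 2)/(8 s³) + (∑_{i ≥ ℓ} d i)²/(4 s²) ]`. -/
theorem cl_triangle_split_bound (r : ℕ) (d : Fin r → ℕ) (hd : ∀ i, 0 < d i)
    (s : ℝ) (hs : s = (∑ i, (d i : ℝ)) / 2) (hs0 : 0 < s) (ℓ : Fin r) :
    clT d s ≤ (∑ i, (d i : ℝ) ^ 2) *
      ((∑ i, (d i : ℝ) ^ 2) * (∑ i ∈ Finset.univ.filter (fun i => i ≤ ℓ), (d i : ℝ) ^ 2) /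
          (8 * s ^ 3) +
        (∑ i ∈ Finset.univ.filter (fun i => ℓ ≤ i), (d i : ℝ)) ^ 2 / (4 * s ^ 2)) := by
  let low : Fin r → ℝ := fun i => if i ≤ ℓ then (d i : ℝ) ^ 2 else 0
  let high : Fin r → ℝ := fun i => if ℓ ≤ i then (d i : ℝ) else 0
  have low_nonneg (i) : 0 ≤ low i := by dsimp only [low]; split_ifs <;> positivity
  have high_nonneg (i) : 0 ≤ high i := by dsimp only [high]; split_ifs <;> positivity
  let F : Fin r × Fin r × Fin r → ℝ := fun t =>
    low t.1 * (d t.2.1 : ℝ) ^ 2 * (d t.2.2 : ℝ) ^ 2 / (8 * s ^ 3) +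
      (d t.1 : ℝ) ^ 2 * high t.2.1 * high t.2.2 / (4 * s ^ 2)
  have F_nonneg (t) : 0 ≤ F t := by
    have h₁ := low_nonneg t.1
    have h₂ := high_nonneg t.2.1
    have h₃ := high_nonneg t.2.2
    positivity
  calc clT d s
      ≤ ∑ t ∈ Finset.univ.filter
          (fun t : Fin r × Fin r × Fin r => t.1 < t.2.1 ∧ t.2.1 < t.2.2), F t := by
        refine Finset.sum_le_sum ?_
        rintro ⟨i, j, k⟩ ht
        obtain ⟨hij, hjk⟩ : i < j ∧ j < k := by simpa using ht
        rcases le_total i ℓ with hi | hi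
        · refine (clP_triangle_le d hs0 i j k).trans ?_
          have h₂ := high_nonneg j
          have h₃ := high_nonneg k
          simp only [F, low, if_pos hi]
          exact le_add_of_nonneg_right (by positivity)
        · refine (clP_triangle_le_of_apex d hs0 i j k).trans ?_
          have h₁ := low_nonneg i
          have hj := hi.trans hij.le
          simp only [F, high, if_pos hj, if_pos (hj.trans hjk.le)]
          exact le_add_of_nonneg_left (by positivity)
    _ ≤ ∑ t, F t :=
        Finset.sum_le_sum_of_subset_of_nonneg (Finset.filter_subset _ _)
          fun t _ _ => F_nonneg t
    _ = _ := by
        simp only [F, Finset.sum_add_distrib, ← Finset.sum_div]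
        rw [sum_prod_mul_mul low (fun j => (d j : ℝ) ^ 2) (fun k => (d k : ℝ) ^ 2),
          sum_prod_mul_mul (fun i => (d i : ℝ) ^ 2) high high,
          Finset.sum_filter, Finset.sum_filter]
        ring
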